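/- Let λ = (λ_1 ≥ … ≥ λ_ℓ ≥ 0) be a partition with at most ℓ parts and suppose λ_i = λ_{i+1} for some 1 ≤ i ≤ ℓ−1. If 2 ≤ i ≤ ℓ−1, then g_λ(x;t) is symmetric in t_{i−1} and t_i, i.e. it is unchanged under exchanging the parameters t_{i−1} and t_i. If i = 1 (i.e. λ_1 = λ_2), then for every 1 ≤ j ≤ n, g_λ(x;t) is unchanged under exchanging the variable x_j with the parameter t_1. -/

import Mathlib

open scoped Classical

noncomputable section

variable {R : Type*} [CommRing R]

/-- The boxes of the Young diagram with row lengths `lam 0, …, lam (ℓ-1)`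
(a box in row `r < ℓ` and column `c < lam r`, both 0-indexed). -/
abbrev YBox (ℓ : ℕ) (lam : ℕ → ℕ) : Type := Σ r : Fin ℓ, Fin (lam r.1)

/-- A reverse plane partition of skew shape `lam/mu` with entries in `{1, …, n}`,
encoded as a filling of the boxes of `lam` by values in `Fin (n+1)`, where the
value `0` is used exactly on the boxes of `mu`; rows weakly increase and
columns weakly increase. -/
def IsSkewRPP (ℓ n : ℕ) (lam mu : ℕ → ℕ) (T : YBox ℓ lam → Fin (n + 1)) : Prop :=
  (∀ b : YBox ℓ lam, ((T b : ℕ) = 0 ↔ (b.2 : ℕ) < mu b.1.1)) ∧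
  (∀ (r : Fin ℓ) (c c' : Fin (lam r.1)), mu r.1 ≤ (c : ℕ) → (c : ℕ) ≤ (c' : ℕ) →
    T ⟨r, c⟩ ≤ T ⟨r, c'⟩) ∧
  (∀ (r r' : Fin ℓ) (c : Fin (lam r.1)) (c' : Fin (lam r'.1)),
    (r : ℕ) ≤ (r' : ℕ) → (c : ℕ) = (c' : ℕ) → mu r.1 ≤ (c : ℕ) → mu r'.1 ≤ (c' : ℕ) →
    T ⟨r, c⟩ ≤ T ⟨r', c'⟩)

/-- The weight of a box `b` of the skew shape `lam/mu` in a reverse plane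
partition `T`: it is `t (r+1)` (`r+1` being the 1-indexed row of `b`) if the box
directly below `b` exists (in `lam`) and carries the same entry, and `x e`
otherwise, where `e ∈ {1, …, n}` is the entry of `b`.  Boxes of `mu` have
weight `1`. -/
def boxWeight (ℓ n : ℕ) (lam mu : ℕ → ℕ) (x t : ℕ → R)
    (T : YBox ℓ lam → Fin (n + 1)) (b : YBox ℓ lam) : R :=
  if mu b.1.1 ≤ (b.2 : ℕ) then
    if ∃ (hr : (b.1 : ℕ) + 1 < ℓ) (hc : (b.2 : ℕ) < lam ((b.1 : ℕ) + 1)),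
        T ⟨⟨(b.1 : ℕ) + 1, hr⟩, ⟨(b.2 : ℕ), hc⟩⟩ = T b
      then t ((b.1 : ℕ) + 1)
      else x (T b : ℕ)
  else 1

/-- The (skew) refined dual Grothendieck polynomial `g_{lam/mu}(x; t)`:
the sum of `∏_r t_r^{b_r(T)} ∏_i x_i^{a_i(T)}` over all reverse plane
partitions `T` of shape `lam/mu` with entries in `{1, …, n}`, where `b_r(T)`
is the number of boxes in row `r` whose entry equals that of the box directly
below it, and `a_i(T)` is the number of columns containing the entry `i`. -/
def dualGroth (ℓ n : ℕ) (lam mu : ℕ → ℕ) (x t : ℕ → R) : R :=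
  ∑ T ∈ Finset.univ.filter (IsSkewRPP ℓ n lam mu),
    ∏ b : YBox ℓ lam, boxWeight ℓ n lam mu x t T b

/-- Complete homogeneous symmetric function `h_k` of the entries of a list. -/
def hL (k : ℕ) (L : List R) : R :=
  ∑ f ∈ Finset.univ.filter (fun f : Fin k → Fin L.length => Monotone f),
    ∏ i, L.get (f i)

/-- Elementary symmetric function `e_k` of the entries of a list. -/
def eL (k : ℕ) (L : List R) : R :=
  ∑ f ∈ Finset.univ.filter (fun f : Fin k → Fin L.length => StrictMono f),
    ∏ i, L.get (f i)

/-- `h_d` for an integer degree `d`, with `h_d = 0` for `d < 0`. -/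
def hInt (d : ℤ) (L : List R) : R := if 0 ≤ d then hL d.toNat L else 0

/-- `e_d` for an integer degree `d`, with `e_d = 0` for `d < 0`. -/
def eInt (d : ℤ) (L : List R) : R := if 0 ≤ d then eL d.toNat L else 0

/-- Extend a function on `Fin ℓ` to `ℕ` by `0`. -/
def extendFin (ℓ : ℕ) (p : Fin ℓ → ℕ) : ℕ → ℕ :=
  fun r => if h : r < ℓ then p ⟨r, h⟩ else 0

/-- A semistandard Young tableau of shape `lam` with entries in `{1, …, N}`
(encoded with values in `Fin (N+1)`, the value `0` being unused): rows weakly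
increase and columns strictly increase. -/
def IsSSYT (ℓ N : ℕ) (lam : ℕ → ℕ) (T : YBox ℓ lam → Fin (N + 1)) : Prop :=
  (∀ b : YBox ℓ lam, 1 ≤ (T b : ℕ)) ∧
  (∀ (r : Fin ℓ) (c c' : Fin (lam r.1)), (c : ℕ) ≤ (c' : ℕ) → T ⟨r, c⟩ ≤ T ⟨r, c'⟩) ∧
  (∀ (r r' : Fin ℓ) (c : Fin (lam r.1)) (c' : Fin (lam r'.1)),
    (r : ℕ) < (r' : ℕ) → (c : ℕ) = (c' : ℕ) → T ⟨r, c⟩ < T ⟨r', c'⟩)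

/-- The Schur polynomial `s_lam (z 1, …, z N)`: the sum of `z^T` over all
semistandard Young tableaux of shape `lam` with entries in `{1, …, N}`. -/
def schurPoly (ℓ N : ℕ) (lam : ℕ → ℕ) (z : ℕ → R) : R :=
  ∑ T ∈ Finset.univ.filter (IsSSYT ℓ N lam),
    ∏ b : YBox ℓ lam, z (T b : ℕ)

/-- The weight of an entry `v` lying between the bounds `a` and `c`: `t` at the lower bound, `u` at
the upper bound, `z v` strictly in between, and `1` if the bounds coincide. -/
def intervalWeight (z : ℕ → R) (t u : R) (a c v : ℕ) : R :=
  if a = c then 1 else if v = a then t else if v = c then u else z v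

/-- The weighted count of weakly increasing sequences `b` with `a ≤ b ≤ c` and entries at most `v`. -/
def boundedSeqSum (N : ℕ) (z : ℕ → R) (t u : R) {m : ℕ} (a c : Fin m → ℕ) (v : ℕ) : R :=
  ∑ b : Fin m → Fin N,
    if Monotone b ∧ ∀ k, a k ≤ b k ∧ (b k : ℕ) ≤ c k ∧ (b k : ℕ) ≤ v then
      ∏ k, intervalWeight z t u (a k) (c k) (b k) else 0

lemma snoc_bounded_iff {N m : ℕ} (a c : Fin (m + 1) → ℕ) (v : ℕ) (w : Fin N) (b : Fin m → Fin N) :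
    (Monotone (Fin.snoc b w : Fin (m + 1) → Fin N) ∧
      ∀ k, a k ≤ (Fin.snoc b w : Fin (m + 1) → Fin N) k ∧
        ((Fin.snoc b w : Fin (m + 1) → Fin N) k : ℕ) ≤ c k ∧
        ((Fin.snoc b w : Fin (m + 1) → Fin N) k : ℕ) ≤ v) ↔
    (a (Fin.last m) ≤ w ∧ (w : ℕ) ≤ c (Fin.last m) ∧ (w : ℕ) ≤ v) ∧
      (Monotone b ∧ ∀ k, a k.castSucc ≤ b k ∧ (b k : ℕ) ≤ c k.castSucc ∧ (b k : ℕ) ≤ w) := by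
  constructor
  · rintro ⟨hm, hb⟩
    refine ⟨by simpa using hb (Fin.last m), fun k k' h => ?_, fun k => ⟨?_, ?_, ?_⟩⟩
    · simpa using hm (Fin.castSucc_le_castSucc_iff.2 h)
    · simpa using (hb k.castSucc).1
    · simpa using (hb k.castSucc).2.1
    · have := hm (Fin.le_last k.castSucc)
      simpa using this
  · rintro ⟨hw, hm, hb⟩
    constructor
    · intro k k' h
      induction k using Fin.lastCases with
      | last =>
        obtain rfl : k' = Fin.last m := le_antisymm (Fin.le_last _) h
        exact le_rfl
      | cast k =>
        induction k' using Fin.lastCases with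
        | last => simpa using (hb k).2.2
        | cast k' => simpa using hm (Fin.castSucc_le_castSucc_iff.1 h)
    · intro k
      induction k using Fin.lastCases with
      | last => simpa using hw
      | cast k => 
        have := hb k
        simp only [Fin.snoc_castSucc]
        omega

lemma boundedSeqSum_succ (N : ℕ) (z : ℕ → R) (t u : R) {m : ℕ} (a c : Fin (m + 1) → ℕ)
    (hc : c (Fin.last m) < N) (v : ℕ) :
    boundedSeqSum N z t u a c v =
      ∑ w ∈ Finset.Icc (a (Fin.last m)) (min (c (Fin.last m)) v),
        intervalWeight z t u (a (Fin.last m)) (c (Fin.last m)) w *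
          boundedSeqSum N z t u (fun k : Fin m => a k.castSucc) (fun k => c k.castSucc) w := by
  have h1 : boundedSeqSum N z t u a c v = ∑ w : Fin N,
      if a (Fin.last m) ≤ w ∧ (w : ℕ) ≤ c (Fin.last m) ∧ (w : ℕ) ≤ v then
        intervalWeight z t u (a (Fin.last m)) (c (Fin.last m)) w *
          boundedSeqSum N z t u (fun k : Fin m => a k.castSucc) (fun k => c k.castSucc) w
      else 0 := by
    unfold boundedSeqSum
    rw [← (Fin.snocEquiv (fun _ : Fin (m + 1) => Fin N)).sum_comp, Fintype.sum_prod_type]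
    refine Finset.sum_congr rfl fun w _ => ?_
    rw [Finset.mul_sum]
    split_ifs with hw
    · refine Finset.sum_congr rfl fun b _ => ?_
      rw [mul_ite, mul_zero]
      refine if_congr ((snoc_bounded_iff a c v w b).trans (and_iff_right hw)) ?_ rfl
      rw [Fin.prod_univ_castSucc, mul_comm]
      simp [Fin.snocEquiv]
    · exact Finset.sum_eq_zero fun b _ =>
        if_neg fun h => hw ((snoc_bounded_iff a c v w b).1 h).1
  rw [h1, Fin.sum_univ_eq_sum_range (fun w => if a (Fin.last m) ≤ w ∧ w ≤ c (Fin.last m) ∧ w ≤ v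
    then intervalWeight z t u (a (Fin.last m)) (c (Fin.last m)) w *
          boundedSeqSum N z t u (fun k : Fin m => a k.castSucc) (fun k => c k.castSucc) w else 0),
    ← Finset.sum_filter]
  refine Finset.sum_congr ?_ fun _ _ => rfl
  ext w
  simp only [Finset.mem_filter, Finset.mem_range, Finset.mem_Icc]
  omega

/-- One step of the recursion for `boundedSeqSum`, in the basis `1, t` over the polynomials
symmetric in `t` and `u`. -/
lemma sum_intervalWeight_decomp (z : ℕ → R) (t u : R) (a c : ℕ) (hac : a < c) (X Y : ℕ → R)
    (hY : ∀ v, c ≤ v → Y v = 0)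
    (hXY : ∀ v, a ≤ v → X (v + 1) + (t + u) * Y (v + 1) =
      X v + (t + u) * Y v + z (v + 1) * Y (v + 1)) (v : ℕ) :
    ∑ w ∈ Finset.Icc a (min c v), intervalWeight z t u a c w * (X w + t * Y w) =
      ∑ w ∈ Finset.Icc a (min c v),
        (if w = a then -(t * u) * Y w else if w = c then (t + u) * X w else z w * X w) +
      t * (if a ≤ v ∧ v < c then X v + (t + u) * Y v else 0) := by
  rcases lt_or_ge v a with hv | hv
  · rw [Finset.Icc_eq_empty (by omega)]
    simp; omega
  induction v, hv using Nat.le_induction with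
  | base =>
    have : min c a = a := by omega
    simp [this, intervalWeight, hac, hac.ne]
    ring
  | succ v hv ih =>
    rcases lt_or_ge v c with h | h
    · have e1 : min c (v + 1) = v + 1 := by omega
      have e2 : min c v = v := by omega
      rw [e1, Finset.sum_Icc_succ_top (by omega), Finset.sum_Icc_succ_top (by omega)]
      rw [e2] at ih
      rw [ih]
      have hne : v + 1 ≠ a := by omega
      have hx := hXY v hv
      rcases (show v + 1 < c ∨ v + 1 = c by omega) with h' | h'
      · simp only [intervalWeight, hac.ne, hne, h'.ne, if_false, hv, h, and_self, if_true,
          h', show a ≤ v + 1 by omega]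
        linear_combination (-t) * hx
      · have hy := hY (v + 1) h'.ge
        rw [hy] at hx ⊢
        subst h'
        simp only [intervalWeight, hac.ne, hne, if_false, hv, h, and_self, if_true, lt_irrefl,
          and_false]
        linear_combination (-t) * hx
    · have e1 : min c (v + 1) = c := by omega
      have e2 : min c v = c := by omega
      rw [e1]
      rw [e2] at ih
      rw [ih]
      simp [h.not_gt, show ¬ v + 1 < c by omega]

lemma boundedSeqSum_decomp (N : ℕ) (z : ℕ → R) (t u : R) {m : ℕ} (a c : Fin m → ℕ)
    (ha : Monotone a) (hc : Monotone c) (hac : a ≤ c) (hN : ∀ k, c k < N) :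
    ∃ X Y : ℕ → R, (∀ v, boundedSeqSum N z t u a c v = X v + t * Y v) ∧
      (∀ v, boundedSeqSum N z u t a c v = X v + u * Y v) ∧
      (∀ v, (∀ k, c k ≤ v) → Y v = 0) ∧
      (∀ v, (∀ k, a k ≤ v) → X (v + 1) + (t + u) * Y (v + 1) =
        X v + (t + u) * Y v + z (v + 1) * Y (v + 1)) := by
  induction m with
  | zero => exact ⟨fun _ => 1, fun _ => 0, by simp [boundedSeqSum, Subsingleton.monotone]⟩
  | succ m ih =>
    obtain ⟨X, Y, hX, hX', hY, hXY⟩ := ih (fun k => a k.castSucc) (fun k => c k.castSucc)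
      (fun k l h => ha (Fin.castSucc_le_castSucc_iff.2 h))
      (fun k l h => hc (Fin.castSucc_le_castSucc_iff.2 h)) (fun k => hac _) (fun k => hN _)
    simp only [boundedSeqSum_succ N z _ _ a c (hN _), hX, hX']
    have ha' : ∀ k, a k ≤ a (Fin.last m) := fun k => ha (Fin.le_last k)
    have hc' : ∀ k, c k ≤ c (Fin.last m) := fun k => hc (Fin.le_last k)
    have hY' : ∀ v, c (Fin.last m) ≤ v → Y v = 0 := fun v hv => hY v fun k => (hc' _).trans hv
    have hXY' := fun v (hv : a (Fin.last m) ≤ v) => hXY v fun k => (ha' _).trans hv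
    have hac' := hac (Fin.last m)
    have hal : ∀ v, (∀ k, a k ≤ v) → a (Fin.last m) ≤ v := fun v h => h _
    have hcl : ∀ v, (∀ k, c k ≤ v) → c (Fin.last m) ≤ v := fun v h => h _
    generalize a (Fin.last m) = a₀ at *
    generalize c (Fin.last m) = c₀ at *
    rcases hac'.eq_or_lt with rfl | hlt
    · have hstep : ∀ (v : ℕ) (f : ℕ → R) (p q : R), ∑ w ∈ Finset.Icc a₀ (min a₀ v),
          intervalWeight z p q a₀ a₀ w * f w = if a₀ ≤ v then f a₀ else 0 := by
        intro v f p q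
        split_ifs with h
        · simp [min_eq_left h, intervalWeight]
        · rw [Finset.Icc_eq_empty (by omega), Finset.sum_empty]
      refine ⟨fun v => if a₀ ≤ v then X a₀ else 0, fun _ => 0, ?_, ?_, ?_, ?_⟩
      · exact fun v => by rw [hstep]; simp [hY']
      · exact fun v => by rw [hstep]; simp [hY']
      · simp
      · intro v hv
        have hv' : a₀ ≤ v := hal v hv
        simp [hv', hv'.trans (Nat.le_succ v)]
    · refine ⟨_, _, sum_intervalWeight_decomp z t u a₀ c₀ hlt X Y hY' hXY', fun v => ?_,
        fun v hv => ?_, fun v hv => ?_⟩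
      · rw [sum_intervalWeight_decomp z u t a₀ c₀ hlt X Y hY' (by simpa only [add_comm u t])]
        simp only [add_comm u t, mul_comm u t]
      · exact if_neg fun h => (hcl v hv).not_gt h.2
      · have hv' : a₀ ≤ v := hal v hv
        have hx := hXY' v hv'
        rcases lt_or_ge v c₀ with h | h
        · rw [min_eq_right h, min_eq_right h.le, Finset.sum_Icc_succ_top (by omega)]
          have hne : v + 1 ≠ a₀ := by omega
          rcases (show v + 1 < c₀ ∨ v + 1 = c₀ by omega) with h' | h'
          · simp only [hne, h'.ne, if_false, hv', h, and_self, if_true, h', hv'.trans (Nat.le_succ v)]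
            linear_combination (t + u) * hx
          · rw [hY' (v + 1) h'.ge] at hx
            simp only [hlt.ne', h', if_false, hv', h, and_self, if_true, lt_irrefl, and_false]
            rw [h'] at hx
            linear_combination (t + u) * hx
        · simp [min_eq_left h, min_eq_left (h.trans (Nat.le_succ v)), h.not_gt,
            show ¬ v + 1 < c₀ by omega]

lemma boundedSeqSum_symm (N : ℕ) (z : ℕ → R) (t u : R) {m : ℕ} (a c : Fin m → ℕ)
    (ha : Monotone a) (hc : Monotone c) (hac : a ≤ c) (hN : ∀ k, c k < N) :
    boundedSeqSum N z t u a c N = boundedSeqSum N z u t a c N := by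
  obtain ⟨X, Y, h, h', hY, -⟩ := boundedSeqSum_decomp N z t u a c ha hc hac hN
  rw [h, h', hY N fun k => (hN k).le, mul_zero, mul_zero]

/-- The sum over weakly increasing sequences between `a` and `c` of the product of the interval
weights is symmetric in the weights `t` and `u` of the two endpoints. -/
theorem sum_monotone_intervalWeight_symm (N : ℕ) (z : ℕ → R) (t u : R) {m : ℕ}
    (a c : Fin m → Fin N) (ha : Monotone a) (hc : Monotone c) (hac : a ≤ c) :
    (∑ b : Fin m → Fin N, if Monotone b ∧ a ≤ b ∧ b ≤ c then
        ∏ k, intervalWeight z t u (a k) (c k) (b k) else 0) =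
      ∑ b : Fin m → Fin N, if Monotone b ∧ a ≤ b ∧ b ≤ c then
        ∏ k, intervalWeight z u t (a k) (c k) (b k) else 0 := by
  have key : ∀ p q : R, (∑ b : Fin m → Fin N, if Monotone b ∧ a ≤ b ∧ b ≤ c then
      ∏ k, intervalWeight z p q (a k) (c k) (b k) else 0) =
      boundedSeqSum N z p q (fun k => (a k : ℕ)) (fun k => (c k : ℕ)) N := by
    intro p q
    refine Finset.sum_congr rfl fun b _ => if_congr (and_congr_right fun _ => ?_) rfl rfl
    simp only [Pi.le_def, ← forall_and, Fin.le_def, (b _).2.le, and_true]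
  rw [key, key]
  exact boundedSeqSum_symm N z t u _ _ ha hc hac fun k => (c k).2

/-- The version of `sum_monotone_intervalWeight_symm` for weakly decreasing sequences. -/
theorem sum_antitone_intervalWeight_symm (N : ℕ) (z : ℕ → R) (t u : R) {m : ℕ}
    (a c : Fin m → Fin N) (ha : Antitone a) (hc : Antitone c) (hac : a ≤ c) :
    (∑ b : Fin m → Fin N, if Antitone b ∧ a ≤ b ∧ b ≤ c then
        ∏ k, intervalWeight z t u (a k) (c k) (b k) else 0) =
      ∑ b : Fin m → Fin N, if Antitone b ∧ a ≤ b ∧ b ≤ c then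
        ∏ k, intervalWeight z u t (a k) (c k) (b k) else 0 := by
  have key : ∀ p q : R, (∑ b : Fin m → Fin N, if Antitone b ∧ a ≤ b ∧ b ≤ c then
      ∏ k, intervalWeight z p q (a k) (c k) (b k) else 0) =
      ∑ b : Fin m → Fin N, if Monotone b ∧ a ∘ Fin.rev ≤ b ∧ b ≤ c ∘ Fin.rev then
      ∏ k, intervalWeight z p q ((a ∘ Fin.rev) k) ((c ∘ Fin.rev) k) (b k) else 0 := by
    intro p q
    rw [← (Equiv.arrowCongr Fin.revPerm (Equiv.refl (Fin N))).sum_comp]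
    refine Finset.sum_congr rfl fun b _ => ?_
    have hb : Equiv.arrowCongr Fin.revPerm (Equiv.refl (Fin N)) b = b ∘ Fin.rev := rfl
    rw [hb]
    refine if_congr (and_congr ?_ (and_congr ?_ ?_)) ?_ rfl
    · exact ⟨fun h k l hkl => by simpa using h (Fin.rev_le_rev.2 hkl),
        fun h k l hkl => h (Fin.rev_le_rev.2 hkl)⟩
    · exact ⟨fun h k => by simpa using h (Fin.rev k), fun h k => by simpa using h (Fin.rev k)⟩
    · exact ⟨fun h k => by simpa using h (Fin.rev k), fun h k => by simpa using h (Fin.rev k)⟩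
    · rw [← Equiv.prod_comp Fin.revPerm]
      simp
  rw [key, key]
  exact sum_monotone_intervalWeight_symm N z t u _ _ (fun k l h => ha (Fin.rev_le_rev.2 h))
    (fun k l h => hc (Fin.rev_le_rev.2 h)) fun k => hac _

/-- Two weighted sums over a product type agree if they agree on every fibre obtained by varying
one coordinate of an admissible point. -/
lemma sum_ite_eq_of_update {ι : Type*} [Fintype ι] [DecidableEq ι] {β : ι → Type*}
    [∀ i, Fintype (β i)] (i : ι)
    (P : (∀ j, β j) → Prop) (w w' : (∀ j, β j) → R)
    (h : ∀ f, P f →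
      (∑ b, if P (Function.update f i b) then w (Function.update f i b) else 0) =
        ∑ b, if P (Function.update f i b) then w' (Function.update f i b) else 0) :
    (∑ f, if P f then w f else 0) = ∑ f, if P f then w' f else 0 := by
  rw [← (Equiv.piSplitAt i β).symm.sum_comp, ← (Equiv.piSplitAt i β).symm.sum_comp,
    Fintype.sum_prod_type_right, Fintype.sum_prod_type_right]
  refine Finset.sum_congr rfl fun g _ => ?_
  by_cases hg : ∃ b, P ((Equiv.piSplitAt i β).symm (b, g))
  · obtain ⟨b₀, hb₀⟩ := hg
    have key : ∀ b, Function.update ((Equiv.piSplitAt i β).symm (b₀, g)) i b =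
        (Equiv.piSplitAt i β).symm (b, g) := by
      intro b
      ext j
      rcases eq_or_ne j i with rfl | hj
      · simp
      · simp [hj]
    simpa only [key] using h _ hb₀
  · push Not at hg
    simp [hg]

section Entry

variable {ℓ n : ℕ} {lam : ℕ → ℕ}

/-- The entries of a filling, extended by `n + 1` outside of the Young diagram. -/
def entry (T : YBox ℓ lam → Fin (n + 1)) (r c : ℕ) : ℕ :=
  if h : r < ℓ ∧ c < lam r then T ⟨⟨r, h.1⟩, ⟨c, h.2⟩⟩ else n + 1

/-- The weight of the box in row `r` and column `c`, or `1` outside of the Young diagram. -/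
def entryWeight (n : ℕ) (x t : ℕ → R) (e : ℕ → ℕ → ℕ) (r c : ℕ) : R :=
  if e r c = n + 1 then 1 else if e (r + 1) c = e r c then t (r + 1) else x (e r c)

lemma entry_of_mem (T : YBox ℓ lam → Fin (n + 1)) {r c : ℕ} (hr : r < ℓ) (hc : c < lam r) :
    entry T r c = T ⟨⟨r, hr⟩, ⟨c, hc⟩⟩ := dif_pos ⟨hr, hc⟩

lemma entry_of_not_mem (T : YBox ℓ lam → Fin (n + 1)) {r c : ℕ} (h : ¬ (r < ℓ ∧ c < lam r)) :
    entry T r c = n + 1 := dif_neg h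

lemma entry_le_iff (T : YBox ℓ lam → Fin (n + 1)) {r c : ℕ} :
    entry T r c ≤ n ↔ r < ℓ ∧ c < lam r := by
  unfold entry
  split_ifs with h
  · simp only [h, and_self, iff_true]
    omega
  · simp only [h, iff_false]
    omega

lemma entry_le (T : YBox ℓ lam → Fin (n + 1)) (r c : ℕ) : entry T r c ≤ n + 1 := by
  unfold entry
  split_ifs <;> omega

lemma boxWeight_eq_entryWeight (x t : ℕ → R) (T : YBox ℓ lam → Fin (n + 1)) (b : YBox ℓ lam) :
    boxWeight ℓ n lam (fun _ => 0) x t T b = entryWeight n x t (entry T) b.1 b.2 := by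
  obtain ⟨⟨r, hr⟩, ⟨c, hc⟩⟩ := b
  have h : (T ⟨⟨r, hr⟩, ⟨c, hc⟩⟩ : ℕ) ≠ n + 1 := by omega
  simp only [boxWeight, entryWeight, entry_of_mem T hr hc, zero_le, if_true, h, if_false]
  refine if_congr ?_ rfl rfl
  unfold entry
  split_ifs with h'
  · simp [h'.1, h'.2, Fin.ext_iff]
  · simp only [h.symm, iff_false]
    rintro ⟨h₁, h₂, -⟩
    exact h' ⟨h₁, h₂⟩

lemma prod_boxWeight (hlam : ∀ a b : ℕ, a ≤ b → b < ℓ → lam b ≤ lam a) (x t : ℕ → R)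
    (T : YBox ℓ lam → Fin (n + 1)) :
    ∏ b, boxWeight ℓ n lam (fun _ => 0) x t T b =
      ∏ r ∈ Finset.range ℓ, ∏ c ∈ Finset.range (lam 0), entryWeight n x t (entry T) r c := by
  rw [Fintype.prod_sigma, ← Fin.prod_univ_eq_prod_range]
  refine Finset.prod_congr rfl fun r _ => ?_
  simp only [boxWeight_eq_entryWeight]
  rw [Fin.prod_univ_eq_prod_range (fun c => entryWeight n x t (entry T) r c)]
  refine Finset.prod_subset (Finset.range_subset_range.2 (hlam 0 r (Nat.zero_le _) r.2)) ?_
  intro c _ hc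
  rw [entryWeight, if_pos]
  exact entry_of_not_mem T fun h => hc (Finset.mem_range.2 h.2)

lemma isSkewRPP_iff_entry (hlam : ∀ a b : ℕ, a ≤ b → b < ℓ → lam b ≤ lam a)
    (T : YBox ℓ lam → Fin (n + 1)) :
    IsSkewRPP ℓ n lam (fun _ => 0) T ↔
      (∀ r c, 1 ≤ entry T r c) ∧ (∀ r, Monotone (entry T r)) ∧
        ∀ c, Monotone fun r => entry T r c := by
  constructor
  · rintro ⟨h1, h2, h3⟩
    refine ⟨fun r c => ?_, fun r c c' h => ?_, fun c r r' h => ?_⟩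
    · unfold entry
      split_ifs with h
      · have := h1 ⟨⟨r, h.1⟩, ⟨c, h.2⟩⟩
        simp only [not_lt_zero, iff_false] at this
        omega
      · omega
    · by_cases h' : r < ℓ ∧ c' < lam r
      · rw [entry_of_mem T h'.1 h'.2, entry_of_mem T h'.1 (h.trans_lt h'.2)]
        exact h2 _ _ _ (Nat.zero_le _) h
      · rw [entry_of_not_mem T h']
        exact entry_le T _ _
    · by_cases h' : r' < ℓ ∧ c < lam r'
      · simp only
        rw [entry_of_mem T h'.1 h'.2,
          entry_of_mem T (h.trans_lt h'.1) (h'.2.trans_le (hlam _ _ h h'.1))]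
        exact h3 _ _ _ _ h rfl (Nat.zero_le _) (Nat.zero_le _)
      · simp only
        rw [entry_of_not_mem T h']
        exact entry_le T _ _
  · rintro ⟨h1, h2, h3⟩
    refine ⟨fun ⟨⟨r, hr⟩, ⟨c, hc⟩⟩ => ?_, fun ⟨r, hr⟩ ⟨c, hc⟩ ⟨c', hc'⟩ _ h => ?_,
      fun ⟨r, hr⟩ ⟨r', hr'⟩ ⟨c, hc⟩ ⟨c', hc'⟩ h h' _ _ => ?_⟩
    · have := h1 r c
      rw [entry_of_mem T hr hc] at this
      simp only [not_lt_zero, iff_false]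
      omega
    · have := h2 r h
      rwa [entry_of_mem T hr hc, entry_of_mem T hr hc'] at this
    · obtain rfl : c = c' := h'
      have := h3 c h
      simp only at this
      rwa [entry_of_mem T hr hc, entry_of_mem T hr' hc'] at this

/-- The filling obtained from `T` by replacing the row `p` by `b`. -/
def updateRow (T : YBox ℓ lam → Fin (n + 1)) (p : Fin ℓ) (b : Fin (lam p) → Fin (n + 1)) :
    YBox ℓ lam → Fin (n + 1) :=
  fun s => Function.update (fun r c => T ⟨r, c⟩ : ∀ r : Fin ℓ, Fin (lam r) → Fin (n + 1)) p b s.1 s.2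

lemma entry_updateRow_of_ne (T : YBox ℓ lam → Fin (n + 1)) (p : Fin ℓ)
    (b : Fin (lam p) → Fin (n + 1)) {r : ℕ} (hr : r ≠ p) (c : ℕ) :
    entry (updateRow T p b) r c = entry T r c := by
  unfold entry
  split_ifs with h
  · simp [updateRow, Function.update_of_ne (show (⟨r, h.1⟩ : Fin ℓ) ≠ p from
      fun h' => hr (congrArg Fin.val h'))]
  · rfl

lemma entry_updateRow_self (T : YBox ℓ lam → Fin (n + 1)) (p : Fin ℓ)
    (b : Fin (lam p) → Fin (n + 1)) (c : Fin (lam p)) :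
    entry (updateRow T p b) p c = b c := by
  rw [entry_of_mem _ p.2 c.2]
  simp [updateRow]

lemma sum_isSkewRPP_eq_of_updateRow (p : Fin ℓ) (w w' : (YBox ℓ lam → Fin (n + 1)) → R)
    (h : ∀ T, IsSkewRPP ℓ n lam (fun _ => 0) T →
      (∑ b, if IsSkewRPP ℓ n lam (fun _ => 0) (updateRow T p b) then w (updateRow T p b) else 0) =
      ∑ b, if IsSkewRPP ℓ n lam (fun _ => 0) (updateRow T p b) then w' (updateRow T p b) else 0) :
    ∑ T ∈ Finset.univ.filter (IsSkewRPP ℓ n lam (fun _ => 0)), w T =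
      ∑ T ∈ Finset.univ.filter (IsSkewRPP ℓ n lam (fun _ => 0)), w' T := by
  rw [Finset.sum_filter, Finset.sum_filter]
  let E := Equiv.piCurry (fun (r : Fin ℓ) (_ : Fin (lam r)) => Fin (n + 1))
  rw [← E.symm.sum_comp, ← E.symm.sum_comp]
  exact sum_ite_eq_of_update p (fun f => IsSkewRPP ℓ n lam (fun _ => 0) (E.symm f))
    (fun f => w (E.symm f)) (fun f => w' (E.symm f)) fun f hf => h (E.symm f) hf

/-- The lower bound imposed on the row `p` by the rows above it. -/
def rowLowerBound (T : YBox ℓ lam → Fin (n + 1)) (p c : ℕ) : ℕ :=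
  if p = 0 then 1 else entry T (p - 1) c

lemma isSkewRPP_updateRow_iff (hlam : ∀ a b : ℕ, a ≤ b → b < ℓ → lam b ≤ lam a)
    {T : YBox ℓ lam → Fin (n + 1)} (hT : IsSkewRPP ℓ n lam (fun _ => 0) T) (p : Fin ℓ)
    (b : Fin (lam p) → Fin (n + 1)) :
    IsSkewRPP ℓ n lam (fun _ => 0) (updateRow T p b) ↔
      Monotone b ∧ (∀ c : Fin (lam p), rowLowerBound T p c ≤ b c) ∧
        ∀ c : Fin (lam p), (b c : ℕ) ≤ entry T (p + 1) c := by
  rw [isSkewRPP_iff_entry hlam] at hT ⊢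
  obtain ⟨h1, h2, h3⟩ := hT
  constructor
  · rintro ⟨g1, g2, g3⟩
    refine ⟨fun c c' h => ?_, fun c => ?_, fun c => ?_⟩
    · have := g2 p (show (c : ℕ) ≤ c' from h)
      rwa [entry_updateRow_self, entry_updateRow_self] at this
    · unfold rowLowerBound
      split_ifs with hp
      · simpa only [entry_updateRow_self] using g1 p c
      · have := g3 c (show (p : ℕ) - 1 ≤ p by omega)
        simp only [entry_updateRow_self] at this
        rwa [entry_updateRow_of_ne _ _ _ (by omega)] at this
    · have := g3 c (show (p : ℕ) ≤ p + 1 by omega)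
      simp only [entry_updateRow_self] at this
      rwa [entry_updateRow_of_ne _ _ _ (by omega)] at this
  · rintro ⟨g1, g2, g3⟩
    have hlo : ∀ c, 1 ≤ rowLowerBound T p c := by
      intro c
      unfold rowLowerBound
      split_ifs
      · exact le_rfl
      · exact h1 _ _
    have hout : ∀ c, ¬ c < lam p → entry (updateRow T p b) p c = n + 1 :=
      fun c hc => entry_of_not_mem _ fun h => hc h.2
    refine ⟨fun r c => ?_, fun r c c' h => ?_, fun c r r' h => ?_⟩
    · rcases eq_or_ne r p with rfl | hr
      · by_cases hc : c < lam p
        · rw [entry_updateRow_self T p b ⟨c, hc⟩]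
          exact (hlo c).trans (g2 ⟨c, hc⟩)
        · rw [hout c hc]
          omega
      · rw [entry_updateRow_of_ne _ _ _ hr]
        exact h1 r c
    · rcases eq_or_ne r p with rfl | hr
      · by_cases hc : c' < lam p
        · rw [entry_updateRow_self T p b ⟨c', hc⟩, entry_updateRow_self T p b ⟨c, h.trans_lt hc⟩]
          exact g1 h
        · rw [hout c' hc]
          exact entry_le _ _ _
      · rw [entry_updateRow_of_ne _ _ _ hr, entry_updateRow_of_ne _ _ _ hr]
        exact h2 r h
    · simp only
      rcases eq_or_ne r p with hr | hr <;> rcases eq_or_ne r' p with hr' | hr'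
      · rw [hr, hr']
      · rw [hr, entry_updateRow_of_ne _ _ _ hr']
        by_cases hc : c < lam p
        · rw [entry_updateRow_self T p b ⟨c, hc⟩]
          exact (g3 ⟨c, hc⟩).trans (h3 c (show (p : ℕ) + 1 ≤ r' by omega))
        · rw [entry_of_not_mem T (r := r')]
          · exact entry_le _ _ _
          · exact fun h' => hc (h'.2.trans_le (hlam _ _ (by omega) h'.1))
      · rw [hr', entry_updateRow_of_ne _ _ _ hr]
        by_cases hc : c < lam p
        · rw [entry_updateRow_self T p b ⟨c, hc⟩]
          refine le_trans ?_ (g2 ⟨c, hc⟩)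
          rw [rowLowerBound, if_neg (by omega)]
          exact h3 c (show r ≤ p - 1 by omega)
        · rw [hout c hc]
          exact entry_le _ _ _
      · rw [entry_updateRow_of_ne _ _ _ hr, entry_updateRow_of_ne _ _ _ hr']
        exact h3 c h

/-- If on every family of reverse plane partitions differing only in row `p` the weights `w` and
`w'` are common multiples of products of interval weights with exchanged endpoints, then their sums
agree. -/
lemma sum_isSkewRPP_eq_of_intervalWeight (hlam : ∀ a b : ℕ, a ≤ b → b < ℓ → lam b ≤ lam a)
    (p : Fin ℓ) (hp : (p : ℕ) + 1 < ℓ) (heq : lam p = lam (p + 1)) (z : ℕ → R) (t u : R)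
    (w w' : (YBox ℓ lam → Fin (n + 1)) → R)
    (h : ∀ T, IsSkewRPP ℓ n lam (fun _ => 0) T → ∃ D : R, ∀ b,
      IsSkewRPP ℓ n lam (fun _ => 0) (updateRow T p b) →
      w (updateRow T p b) = D * ∏ c : Fin (lam p),
        intervalWeight z t u (rowLowerBound T p c) (entry T (p + 1) c) (b c) ∧
      w' (updateRow T p b) = D * ∏ c : Fin (lam p),
        intervalWeight z u t (rowLowerBound T p c) (entry T (p + 1) c) (b c)) :
    ∑ T ∈ Finset.univ.filter (IsSkewRPP ℓ n lam (fun _ => 0)), w T =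
      ∑ T ∈ Finset.univ.filter (IsSkewRPP ℓ n lam (fun _ => 0)), w' T := by
  refine sum_isSkewRPP_eq_of_updateRow p w w' fun T hT => ?_
  obtain ⟨D, hD⟩ := h T hT
  obtain ⟨h1, h2, h3⟩ := (isSkewRPP_iff_entry hlam T).1 hT
  have hloT : ∀ c, rowLowerBound T p c ≤ entry T p c := by
    intro c
    unfold rowLowerBound
    split_ifs with h0
    · exact h1 _ _
    · exact h3 c (show (p : ℕ) - 1 ≤ p by omega)
  have hlo : ∀ c : Fin (lam p), rowLowerBound T p c < n + 1 := fun c =>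
    Nat.lt_succ_of_le ((hloT c).trans ((entry_le_iff T).2 ⟨p.2, c.2⟩))
  have hhi : ∀ c : Fin (lam p), entry T (p + 1) c < n + 1 := fun c =>
    Nat.lt_succ_of_le ((entry_le_iff T).2 ⟨hp, heq ▸ c.2⟩)
  have key := sum_monotone_intervalWeight_symm (n + 1) z t u (fun c => ⟨_, hlo c⟩)
    (fun c => ⟨_, hhi c⟩) ?_ (fun c c' hc => h2 _ hc) ?_
  · have key' := congrArg (D * ·) key
    simp only [Finset.mul_sum, mul_ite, mul_zero] at key'
    convert key' using 2 with b _ b _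
    · by_cases hb : IsSkewRPP ℓ n lam (fun _ => 0) (updateRow T p b)
      · rw [if_pos hb, (hD b hb).1]
        exact (if_pos ((isSkewRPP_updateRow_iff hlam hT p b).1 hb)).symm
      · rw [if_neg hb]
        exact (if_neg fun hb' => hb ((isSkewRPP_updateRow_iff hlam hT p b).2 hb')).symm
    · by_cases hb : IsSkewRPP ℓ n lam (fun _ => 0) (updateRow T p b)
      · rw [if_pos hb, (hD b hb).2]
        exact (if_pos ((isSkewRPP_updateRow_iff hlam hT p b).1 hb)).symm
      · rw [if_neg hb]
        exact (if_neg fun hb' => hb ((isSkewRPP_updateRow_iff hlam hT p b).2 hb')).symm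
  · intro c c' hc
    simp only [Fin.mk_le_mk, rowLowerBound]
    split_ifs
    · exact le_rfl
    · exact h2 _ hc
  · exact fun c => (hloT c).trans (h3 c (show (p : ℕ) ≤ p + 1 by omega))

lemma entryWeight_updateRow_of_ne (x t : ℕ → R) (T : YBox ℓ lam → Fin (n + 1)) (p : Fin ℓ)
    (b : Fin (lam p) → Fin (n + 1)) {r : ℕ} (hr : r ≠ p) (hr' : r + 1 ≠ p) (c : ℕ) :
    entryWeight n x t (entry (updateRow T p b)) r c = entryWeight n x t (entry T) r c := by
  simp only [entryWeight, entry_updateRow_of_ne _ _ _ hr, entry_updateRow_of_ne _ _ _ hr']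

/-- The part of the weight of `T` that does not depend on the row `p` and is symmetric in
`t p` and `t (p + 1)`. -/
def rowCofactor (x t : ℕ → R) (T : YBox ℓ lam → Fin (n + 1)) (p : ℕ) : R :=
  (∏ r ∈ ((Finset.range ℓ).erase p).erase (p - 1),
    ∏ c ∈ Finset.range (lam 0), entryWeight n x t (entry T) r c) *
  (∏ c ∈ Finset.Ico (lam p) (lam 0),
    if entry T (p - 1) c = n + 1 then 1 else x (entry T (p - 1) c)) *
  ∏ c ∈ Finset.range (lam p),
    if entry T (p - 1) c = entry T (p + 1) c then t p * t (p + 1) else x (entry T (p - 1) c)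

lemma rowCofactor_comp_swap (x t : ℕ → R) (T : YBox ℓ lam → Fin (n + 1)) {p : ℕ} (hp : 1 ≤ p) :
    rowCofactor x (t ∘ Equiv.swap p (p + 1)) T p = rowCofactor x t T p := by
  unfold rowCofactor
  congr 1
  · congr 1
    refine Finset.prod_congr rfl fun r hr => Finset.prod_congr rfl fun c _ => ?_
    simp only [Finset.mem_erase] at hr
    simp only [entryWeight, Function.comp]
    rw [Equiv.swap_apply_of_ne_of_ne (by omega) (by omega)]
  · simp [mul_comm]

lemma prod_boxWeight_updateRow (hlam : ∀ a b : ℕ, a ≤ b → b < ℓ → lam b ≤ lam a) (x t : ℕ → R)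
    (T : YBox ℓ lam → Fin (n + 1)) (p : Fin ℓ) (h0 : 1 ≤ (p : ℕ)) (hp : (p : ℕ) + 1 < ℓ)
    (heq : lam p = lam (p + 1)) (b : Fin (lam p) → Fin (n + 1))
    (hT : IsSkewRPP ℓ n lam (fun _ => 0) T)
    (hb : IsSkewRPP ℓ n lam (fun _ => 0) (updateRow T p b)) :
    ∏ s, boxWeight ℓ n lam (fun _ => 0) x t (updateRow T p b) s =
      rowCofactor x t T p * ∏ c : Fin (lam p),
        intervalWeight x (t p) (t (p + 1)) (rowLowerBound T p c) (entry T (p + 1) c) (b c) := by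
  have hM : lam p ≤ lam 0 := hlam _ _ (Nat.zero_le _) p.2
  obtain ⟨-, hb2, hb3⟩ := (isSkewRPP_updateRow_iff hlam hT p b).1 hb
  rw [prod_boxWeight hlam, ← Finset.mul_prod_erase _ _ (Finset.mem_range.2 p.2),
    ← Finset.mul_prod_erase _ _ (show (p : ℕ) - 1 ∈ (Finset.range ℓ).erase p by
      simp only [Finset.mem_erase, Finset.mem_range]; omega)]
  have h1 : ∏ r ∈ ((Finset.range ℓ).erase p).erase (p - 1), ∏ c ∈ Finset.range (lam 0),
      entryWeight n x t (entry (updateRow T p b)) r c =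
      ∏ r ∈ ((Finset.range ℓ).erase p).erase (p - 1), ∏ c ∈ Finset.range (lam 0),
        entryWeight n x t (entry T) r c := by
    refine Finset.prod_congr rfl fun r hr => Finset.prod_congr rfl fun c _ => ?_
    simp only [Finset.mem_erase] at hr
    exact entryWeight_updateRow_of_ne _ _ _ _ _ (by omega) (by omega) c
  rw [h1, ← mul_assoc, ← Finset.prod_mul_distrib, ← Finset.prod_range_mul_prod_Ico _ hM,
    rowCofactor]
  have h2 : ∏ c ∈ Finset.Ico (lam p) (lam 0),
      entryWeight n x t (entry (updateRow T p b)) p c *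
        entryWeight n x t (entry (updateRow T p b)) (p - 1) c =
      ∏ c ∈ Finset.Ico (lam p) (lam 0),
        if entry T (p - 1) c = n + 1 then 1 else x (entry T (p - 1) c) := by
    refine Finset.prod_congr rfl fun c hc => ?_
    have hc' : entry (updateRow T p b) p c = n + 1 :=
      entry_of_not_mem _ fun h => (Finset.mem_Ico.1 hc).1.not_gt h.2
    rw [entryWeight, if_pos hc', one_mul, entryWeight, entry_updateRow_of_ne _ _ _ (by omega),
      Nat.sub_add_cancel h0, hc']
    split_ifs with h h'
    · rfl
    · exact absurd h'.symm h
    · rfl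
  have h3 : ∏ c ∈ Finset.range (lam p),
      entryWeight n x t (entry (updateRow T p b)) p c *
        entryWeight n x t (entry (updateRow T p b)) (p - 1) c =
      (∏ c ∈ Finset.range (lam p), if entry T (p - 1) c = entry T (p + 1) c
        then t p * t (p + 1) else x (entry T (p - 1) c)) *
      ∏ c : Fin (lam p),
        intervalWeight x (t p) (t (p + 1)) (rowLowerBound T p c) (entry T (p + 1) c) (b c) := by
    rw [← Fin.prod_univ_eq_prod_range, ← Fin.prod_univ_eq_prod_range, ← Finset.prod_mul_distrib]
    refine Finset.prod_congr rfl fun c _ => ?_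
    have hlo := hb2 c
    have hhi := hb3 c
    have hn : entry T (p + 1) c ≤ n := (entry_le_iff T).2 ⟨hp, heq ▸ c.2⟩
    have hlow : rowLowerBound T p c = entry T (p - 1) c := if_neg (by omega)
    rw [hlow] at hlo ⊢
    simp only [entryWeight, Nat.sub_add_cancel h0, entry_updateRow_self,
      entry_updateRow_of_ne T p b (show (p : ℕ) - 1 ≠ p by omega),
      entry_updateRow_of_ne T p b (show (p : ℕ) + 1 ≠ p by omega), intervalWeight]
    generalize (b c : ℕ) = β at *
    generalize entry T (p - 1) c = α at *
    generalize entry T (p + 1) c = γ at *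
    rw [if_neg (show β ≠ n + 1 by omega), if_neg (show α ≠ n + 1 by omega)]
    rcases eq_or_ne α γ with rfl | h
    · obtain rfl : α = β := by omega
      simp [mul_comm]
    · rcases eq_or_ne β α with rfl | h'
      · simp [h, h.symm]
      · rcases eq_or_ne β γ with rfl | h''
        · simp [h, h.symm, mul_comm]
        · simp [h, h', h''.symm, h'', mul_comm]
  rw [h2, h3]
  ring

/-- Symmetry in two consecutive parameters `t p` and `t (p + 1)`. -/
theorem dualGroth_comp_swap (hlam : ∀ a b : ℕ, a ≤ b → b < ℓ → lam b ≤ lam a) (x t : ℕ → R)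
    {p : ℕ} (h0 : 1 ≤ p) (hp : p + 1 < ℓ) (heq : lam p = lam (p + 1)) :
    dualGroth ℓ n lam (fun _ => 0) x t =
      dualGroth ℓ n lam (fun _ => 0) x (t ∘ Equiv.swap p (p + 1)) := by
  refine sum_isSkewRPP_eq_of_intervalWeight hlam ⟨p, by omega⟩ hp heq x (t p) (t (p + 1)) _ _
    fun T hT => ⟨rowCofactor x t T p, fun b hb => ⟨?_, ?_⟩⟩
  · exact prod_boxWeight_updateRow hlam x t T _ h0 hp heq b hT hb
  · rw [prod_boxWeight_updateRow hlam x _ T ⟨p, by omega⟩ h0 hp heq b hT hb,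
      rowCofactor_comp_swap x t T h0]
    simp

lemma prod_entryWeight_column (x t : ℕ → R) (hn : 1 ≤ n) (e : ℕ → ℕ → ℕ) (c : ℕ)
    (h1 : ∀ r, 1 ≤ e r c) (h3 : Monotone fun r => e r c) (h : ℕ) :
    ∏ r ∈ Finset.range h, entryWeight n x t e r c =
      (if e 0 c = 1 ∧ e h c ≠ 1 then x 1 else 1) *
        ∏ r ∈ Finset.range h, entryWeight n (Function.update x 1 1) t e r c := by
  induction h with
  | zero => simp
  | succ h ih =>
    rw [Finset.prod_range_succ, Finset.prod_range_succ, ih]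
    have h0 : e 0 c ≤ e h c := h3 (Nat.zero_le h)
    have hs : e h c ≤ e (h + 1) c := h3 (Nat.le_succ h)
    have h10 := h1 0
    generalize (∏ r ∈ Finset.range h, entryWeight n (Function.update x 1 1) t e r c) = Q
    simp only [entryWeight]
    generalize e 0 c = α at *
    generalize e h c = β at *
    generalize e (h + 1) c = γ at *
    rcases eq_or_ne γ β with rfl | hne
    · rcases eq_or_ne γ (n + 1) with hγ | hγ
      · simp [hγ]
      · simp [hγ, mul_assoc]
    · rcases eq_or_ne β 1 with rfl | hβ
      · obtain rfl : α = 1 := by omega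
        simp [hne, show n ≠ 0 by omega, mul_comm]
      · have : γ ≠ 1 := by omega
        simp [hne, hβ, this, mul_assoc]

lemma prod_boxWeight_eq_update (hlam : ∀ a b : ℕ, a ≤ b → b < ℓ → lam b ≤ lam a) (x t : ℕ → R)
    (hn : 1 ≤ n) (T : YBox ℓ lam → Fin (n + 1)) (hT : IsSkewRPP ℓ n lam (fun _ => 0) T) :
    ∏ s, boxWeight ℓ n lam (fun _ => 0) x t T s =
      (∏ c ∈ Finset.range (lam 0), if entry T 0 c = 1 then x 1 else 1) *
        ∏ r ∈ Finset.range ℓ, ∏ c ∈ Finset.range (lam 0),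
          entryWeight n (Function.update x 1 1) t (entry T) r c := by
  obtain ⟨h1, -, h3⟩ := (isSkewRPP_iff_entry hlam T).1 hT
  rw [prod_boxWeight hlam, Finset.prod_comm, Finset.prod_comm (s := Finset.range ℓ),
    ← Finset.prod_mul_distrib]
  refine Finset.prod_congr rfl fun c _ => ?_
  rw [prod_entryWeight_column x t hn (entry T) c (fun r => h1 r c) (h3 c) ℓ]
  have : entry T ℓ c ≠ 1 := by
    rw [entry_of_not_mem T fun h => lt_irrefl _ h.1]
    omega
  simp [this]

/-- The part of the weight of `T` that does not depend on the first row and is symmetric in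
`x 1` and `t 1`. -/
def firstRowCofactor (x t : ℕ → R) (T : YBox ℓ lam → Fin (n + 1)) : R :=
  (∏ r ∈ (Finset.range ℓ).erase 0, ∏ c ∈ Finset.range (lam 0),
    entryWeight n (Function.update x 1 1) t (entry T) r c) *
  ∏ c ∈ Finset.range (lam 0), if 1 = entry T 1 c then x 1 * t 1 else 1

lemma firstRowCofactor_update (x t : ℕ → R) (T : YBox ℓ lam → Fin (n + 1)) :
    firstRowCofactor (Function.update x 1 (t 1)) (Function.update t 1 (x 1)) T =
      firstRowCofactor x t T := by
  unfold firstRowCofactor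
  congr 1
  · refine Finset.prod_congr rfl fun r hr => Finset.prod_congr rfl fun c _ => ?_
    simp only [Finset.mem_erase] at hr
    simp only [entryWeight, Function.update_idem]
    rw [Function.update_of_ne (show r + 1 ≠ 1 by omega)]
  · simp [mul_comm]

lemma prod_boxWeight_updateRow_zero (hlam : ∀ a b : ℕ, a ≤ b → b < ℓ → lam b ≤ lam a)
    (x t : ℕ → R) (hn : 1 ≤ n) (T : YBox ℓ lam → Fin (n + 1)) (h0 : 0 < ℓ) (hp : 1 < ℓ)
    (heq : lam 0 = lam 1) (b : Fin (lam 0) → Fin (n + 1))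
    (hT : IsSkewRPP ℓ n lam (fun _ => 0) T)
    (hb : IsSkewRPP ℓ n lam (fun _ => 0) (updateRow T ⟨0, h0⟩ b)) :
    ∏ s, boxWeight ℓ n lam (fun _ => 0) x t (updateRow T ⟨0, h0⟩ b) s =
      firstRowCofactor x t T * ∏ c : Fin (lam 0),
        intervalWeight (Function.update x 1 1) (x 1) (t 1) (rowLowerBound T 0 c) (entry T 1 c)
          (b c) := by
  obtain ⟨-, hb2, hb3⟩ := (isSkewRPP_updateRow_iff hlam hT ⟨0, h0⟩ b).1 hb
  rw [prod_boxWeight_eq_update hlam x t hn _ hb,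
    ← Finset.mul_prod_erase _ _ (Finset.mem_range.2 h0)]
  have h1 : ∏ r ∈ (Finset.range ℓ).erase 0, ∏ c ∈ Finset.range (lam 0),
      entryWeight n (Function.update x 1 1) t (entry (updateRow T ⟨0, h0⟩ b)) r c =
      ∏ r ∈ (Finset.range ℓ).erase 0, ∏ c ∈ Finset.range (lam 0),
        entryWeight n (Function.update x 1 1) t (entry T) r c := by
    refine Finset.prod_congr rfl fun r hr => Finset.prod_congr rfl fun c _ => ?_
    simp only [Finset.mem_erase] at hr
    exact entryWeight_updateRow_of_ne _ _ _ _ _ hr.1 (Nat.succ_ne_zero r) c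
  rw [h1, ← mul_assoc, ← Finset.prod_mul_distrib, firstRowCofactor, mul_comm, mul_assoc]
  congr 1
  rw [← Fin.prod_univ_eq_prod_range, ← Fin.prod_univ_eq_prod_range, ← Finset.prod_mul_distrib]
  refine Finset.prod_congr rfl fun c _ => ?_
  have hlo : 1 ≤ (b c : ℕ) := hb2 c
  have hhi : (b c : ℕ) ≤ entry T 1 c := hb3 c
  have hγ : entry T 1 c ≤ n := (entry_le_iff T).2 ⟨hp, heq ▸ c.2⟩
  have e0 : entry (updateRow T ⟨0, h0⟩ b) 0 c = b c := entry_updateRow_self T ⟨0, h0⟩ b c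
  have e1 : entry (updateRow T ⟨0, h0⟩ b) (0 + 1) c = entry T 1 c :=
    entry_updateRow_of_ne T ⟨0, h0⟩ b (r := 1) one_ne_zero c
  simp only [entryWeight, e0, e1, intervalWeight, rowLowerBound, if_true]
  generalize (b c : ℕ) = β at *
  generalize entry T 1 c = γ at *
  rw [if_neg (show β ≠ n + 1 by omega)]
  rcases eq_or_ne 1 γ with rfl | h
  · obtain rfl : β = 1 := by omega
    simp
  · rcases eq_or_ne β 1 with rfl | h'
    · simp [h, h.symm]
    · rcases eq_or_ne β γ with rfl | h''
      · simp [h, h']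
      · simp [h, h', h''.symm, h'']

/-- Symmetry in the variable `x 1` and the parameter `t 1`. -/
theorem dualGroth_update_one (hlam : ∀ a b : ℕ, a ≤ b → b < ℓ → lam b ≤ lam a) (x t : ℕ → R)
    (hn : 1 ≤ n) (hp : 1 < ℓ) (heq : lam 0 = lam 1) :
    dualGroth ℓ n lam (fun _ => 0) x t =
      dualGroth ℓ n lam (fun _ => 0) (Function.update x 1 (t 1)) (Function.update t 1 (x 1)) := by
  have h0 : 0 < ℓ := by omega
  refine sum_isSkewRPP_eq_of_intervalWeight hlam ⟨0, h0⟩ hp heq (Function.update x 1 1) (x 1) (t 1)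
    _ _ fun T hT => ⟨firstRowCofactor x t T, fun b hb => ⟨?_, ?_⟩⟩
  · exact prod_boxWeight_updateRow_zero hlam x t hn T h0 hp heq b hT hb
  · rw [prod_boxWeight_updateRow_zero hlam _ _ hn T h0 hp heq b hT hb, firstRowCofactor_update]
    simp

lemma lt_card_filter_range_iff {P : ℕ → Prop} [DecidablePred P]
    (hP : ∀ a b, a ≤ b → P b → P a) (N r : ℕ) :
    r < ((Finset.range N).filter P).card ↔ r < N ∧ P r := by
  constructor
  · intro h
    by_contra hr
    refine h.not_ge ?_
    calc ((Finset.range N).filter P).card ≤ (Finset.range r).card := by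
          refine Finset.card_le_card fun s hs => ?_
          simp only [Finset.mem_filter, Finset.mem_range] at hs ⊢
          by_contra hrs
          exact hr ⟨(not_lt.1 hrs).trans_lt hs.1, hP _ _ (not_lt.1 hrs) hs.2⟩
      _ = r := Finset.card_range r
  · rintro ⟨h1, h2⟩
    calc r < (Finset.range (r + 1)).card := by simp
      _ ≤ _ := by
          refine Finset.card_le_card fun s hs => ?_
          simp only [Finset.mem_filter, Finset.mem_range] at hs ⊢
          exact ⟨by omega, hP _ _ (by omega) h2⟩

/-- The number of boxes in the column `c` with entry at most `v`. -/
def levelHeight (T : YBox ℓ lam → Fin (n + 1)) (v c : ℕ) : ℕ :=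
  ((Finset.range ℓ).filter fun r => entry T r c ≤ v).card

/-- `levelHeight` as a point of a finite type. -/
def heights (T : YBox ℓ lam → Fin (n + 1)) : Fin (n + 1) → Fin (lam 0) → Fin (ℓ + 1) :=
  fun v c => ⟨levelHeight T v c, Nat.lt_succ_of_le
    ((Finset.card_filter_le _ _).trans (Finset.card_range ℓ).le)⟩

/-- The filling whose entries at most `v` in the column `c` are the top `H v c` ones. -/
def fillingOfHeights (H : Fin (n + 1) → Fin (lam 0) → Fin (ℓ + 1)) (s : YBox ℓ lam) :
    Fin (n + 1) :=
  ⟨((Finset.range n).filter fun v => ∃ (hv : v < n + 1) (hc : (s.2 : ℕ) < lam 0),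
    (H ⟨v, hv⟩ ⟨s.2, hc⟩ : ℕ) ≤ s.1).card, Nat.lt_succ_of_le
    ((Finset.card_filter_le _ _).trans (Finset.card_range n).le)⟩

/-- The characterization of the arrays of the form `heights T`. -/
def IsHeights (H : Fin (n + 1) → Fin (lam 0) → Fin (ℓ + 1)) : Prop :=
  (∀ c, H 0 c = 0) ∧ (∀ c r, r < (H (Fin.last n) c : ℕ) ↔ r < ℓ ∧ (c : ℕ) < lam r) ∧
    Monotone H ∧ ∀ v, Antitone (H v)

lemma lt_levelHeight_iff (hlam : ∀ a b : ℕ, a ≤ b → b < ℓ → lam b ≤ lam a)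
    {T : YBox ℓ lam → Fin (n + 1)} (hT : IsSkewRPP ℓ n lam (fun _ => 0) T) {v : ℕ} (hv : v ≤ n)
    (c r : ℕ) : r < levelHeight T v c ↔ entry T r c ≤ v := by
  obtain ⟨-, -, h3⟩ := (isSkewRPP_iff_entry hlam T).1 hT
  rw [levelHeight, lt_card_filter_range_iff (P := fun r => entry T r c ≤ v)
    fun a b hab hb => (h3 c hab).trans hb]
  exact and_iff_right_of_imp fun h => ((entry_le_iff T).1 (h.trans hv)).1

lemma isHeights_heights (hlam : ∀ a b : ℕ, a ≤ b → b < ℓ → lam b ≤ lam a)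
    {T : YBox ℓ lam → Fin (n + 1)} (hT : IsSkewRPP ℓ n lam (fun _ => 0) T) :
    IsHeights (heights T) := by
  obtain ⟨h1, h2, -⟩ := (isSkewRPP_iff_entry hlam T).1 hT
  refine ⟨fun c => ?_, fun c r => ?_, fun v w hvw c => ?_, fun v c c' hc => ?_⟩
  · refine Fin.ext (Nat.eq_zero_of_not_pos fun h => ?_)
    have := (lt_levelHeight_iff hlam hT (Nat.zero_le n) c 0).1 h
    have := h1 0 c
    omega
  · exact (lt_levelHeight_iff hlam hT le_rfl c r).trans (entry_le_iff T)
  · refine Fin.le_def.2 (le_of_forall_lt fun r hr => ?_)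
    exact (lt_levelHeight_iff hlam hT (Nat.le_of_lt_succ w.2) c r).2
      (((lt_levelHeight_iff hlam hT (Nat.le_of_lt_succ v.2) c r).1 hr).trans hvw)
  · refine Fin.le_def.2 (le_of_forall_lt fun r hr => ?_)
    exact (lt_levelHeight_iff hlam hT (Nat.le_of_lt_succ v.2) c r).2
      ((h2 r hc).trans ((lt_levelHeight_iff hlam hT (Nat.le_of_lt_succ v.2) c' r).1 hr))

lemma entry_fillingOfHeights_le_iff {H : Fin (n + 1) → Fin (lam 0) → Fin (ℓ + 1)}
    (hH : IsHeights H) (r : ℕ) (c : Fin (lam 0)) (v : Fin (n + 1)) :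
    entry (fillingOfHeights H) r c ≤ v ↔ r < (H v c : ℕ) := by
  obtain ⟨-, h2, h3, -⟩ := hH
  by_cases h : r < ℓ ∧ (c : ℕ) < lam r
  · rw [entry_of_mem _ h.1 h.2, ← not_iff_not, not_le, not_lt]
    simp only [fillingOfHeights]
    rw [lt_card_filter_range_iff]
    · constructor
      · rintro ⟨_, _, _, h'⟩
        exact h'
      · refine fun h' => ⟨?_, v.2, c.2, h'⟩
        by_contra hv
        obtain rfl : v = Fin.last n := Fin.ext (by simp only [Fin.val_last]; omega)
        exact h'.not_gt ((h2 c r).2 h)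
    · rintro a b hab ⟨hb, hc, h'⟩
      exact ⟨by omega, hc, le_trans (h3 (Fin.mk_le_mk.2 hab) _) h'⟩
  · refine iff_of_false (fun h' => h ((entry_le_iff _).1 (h'.trans (Nat.le_of_lt_succ v.2)))) ?_
    exact fun h' => h ((h2 c r).1 (h'.trans_le (h3 (Fin.le_last v) c)))

lemma entry_eq_of_forall_le_iff {T T' : YBox ℓ lam → Fin (n + 1)} {r c r' c' : ℕ}
    (h : ∀ v ≤ n, entry T r c ≤ v ↔ entry T' r' c' ≤ v) : entry T r c = entry T' r' c' := by
  have h1 := entry_le T r c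
  have h2 := entry_le T' r' c'
  have h3 := h (entry T r c)
  have h4 := h (entry T' r' c')
  omega

lemma isSkewRPP_fillingOfHeights (hlam : ∀ a b : ℕ, a ≤ b → b < ℓ → lam b ≤ lam a)
    {H : Fin (n + 1) → Fin (lam 0) → Fin (ℓ + 1)} (hH : IsHeights H) :
    IsSkewRPP ℓ n lam (fun _ => 0) (fillingOfHeights H) := by
  have key : ∀ {r c : ℕ}, entry (fillingOfHeights H) r c ≤ n → c < lam 0 := fun h =>
    have h' := (entry_le_iff _).1 h
    h'.2.trans_le (hlam _ _ (Nat.zero_le _) h'.1)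
  have mono : ∀ {r c r' c' : ℕ}, (∀ v ≤ n, entry (fillingOfHeights H) r' c' ≤ v →
      entry (fillingOfHeights H) r c ≤ v) →
      entry (fillingOfHeights H) r c ≤ entry (fillingOfHeights H) r' c' := by
    intro r c r' c' h
    by_cases h' : entry (fillingOfHeights H) r' c' ≤ n
    · exact h _ h' le_rfl
    · have := entry_le (fillingOfHeights H) r c
      omega
  refine (isSkewRPP_iff_entry hlam _).2 ⟨fun r c => ?_, fun r c c' h => mono fun v hv h' => ?_,
    fun c r r' h => mono fun v hv h' => ?_⟩
  · by_contra h
    have h0 : entry (fillingOfHeights H) r c ≤ 0 := by omega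
    have hc := key (h0.trans (Nat.zero_le n))
    have := (entry_fillingOfHeights_le_iff hH r ⟨c, hc⟩ 0).1 h0
    simp [hH.1] at this
  · have hc := key (h'.trans hv)
    exact (entry_fillingOfHeights_le_iff hH r ⟨c, h.trans_lt hc⟩ ⟨v, Nat.lt_succ_of_le hv⟩).2
      (((entry_fillingOfHeights_le_iff hH r ⟨c', hc⟩ ⟨v, Nat.lt_succ_of_le hv⟩).1 h').trans_le
        (hH.2.2.2 _ (Fin.mk_le_mk.2 h)))
  · have hc := key (h'.trans hv)
    exact (entry_fillingOfHeights_le_iff hH r ⟨c, hc⟩ ⟨v, Nat.lt_succ_of_le hv⟩).2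
      (h.trans_lt ((entry_fillingOfHeights_le_iff hH r' ⟨c, hc⟩ ⟨v, Nat.lt_succ_of_le hv⟩).1 h'))

lemma heights_fillingOfHeights (hlam : ∀ a b : ℕ, a ≤ b → b < ℓ → lam b ≤ lam a)
    {H : Fin (n + 1) → Fin (lam 0) → Fin (ℓ + 1)} (hH : IsHeights H) :
    heights (fillingOfHeights H) = H := by
  ext v c
  refine eq_of_forall_lt_iff fun r => ?_
  exact (lt_levelHeight_iff hlam (isSkewRPP_fillingOfHeights hlam hH)
    (Nat.le_of_lt_succ v.2) c r).trans (entry_fillingOfHeights_le_iff hH r c v)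

lemma fillingOfHeights_heights (hlam : ∀ a b : ℕ, a ≤ b → b < ℓ → lam b ≤ lam a)
    {T : YBox ℓ lam → Fin (n + 1)} (hT : IsSkewRPP ℓ n lam (fun _ => 0) T) :
    fillingOfHeights (heights T) = T := by
  ext ⟨⟨r, hr⟩, ⟨c, hc⟩⟩
  rw [← entry_of_mem _ hr hc, ← entry_of_mem _ hr hc]
  refine entry_eq_of_forall_le_iff fun v hv => ?_
  have hc0 : c < lam 0 := hc.trans_le (hlam _ _ (Nat.zero_le _) hr)
  exact (entry_fillingOfHeights_le_iff (isHeights_heights hlam hT) r ⟨c, hc0⟩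
    ⟨v, Nat.lt_succ_of_le hv⟩).trans (lt_levelHeight_iff hlam hT hv c r)

/-- The weight of a vertical strip of equal entries of variable `y` in the rows `a, …, b - 1` of a
single column. -/
def stripWeight (y : R) (t : ℕ → R) (a b : ℕ) : R :=
  if a < b then y * ∏ r ∈ Finset.Ico (a + 1) b, t r else 1

lemma prod_Ico_ite_eq_stripWeight (y : R) (t : ℕ → R) (a b : ℕ) :
    (∏ r ∈ Finset.Ico a b, if r + 1 < b then t (r + 1) else y) = stripWeight y t a b := by
  unfold stripWeight
  split_ifs with h
  · obtain ⟨b, rfl⟩ : ∃ d, b = d + 1 := ⟨b - 1, by omega⟩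
    rw [Finset.prod_Ico_succ_top (by omega), if_neg (lt_irrefl _), mul_comm,
      ← Finset.prod_Ico_add' t a b 1]
    congr 1
    refine Finset.prod_congr rfl fun r hr => if_pos ?_
    have := (Finset.mem_Ico.1 hr).2
    omega
  · rw [Finset.Ico_eq_empty h, Finset.prod_empty]

lemma prod_entryWeight_eq_prod_stripWeight (hlam : ∀ a b : ℕ, a ≤ b → b < ℓ → lam b ≤ lam a)
    (x t : ℕ → R) {T : YBox ℓ lam → Fin (n + 1)} (hT : IsSkewRPP ℓ n lam (fun _ => 0) T) (c : ℕ) :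
    ∏ r ∈ Finset.range ℓ, entryWeight n x t (entry T) r c =
      ∏ v ∈ Finset.range n,
        stripWeight (x (v + 1)) t (levelHeight T v c) (levelHeight T (v + 1) c) := by
  obtain ⟨h1, -, h3⟩ := (isSkewRPP_iff_entry hlam T).1 hT
  have hle : levelHeight T n c ≤ ℓ := (Finset.card_filter_le _ _).trans (Finset.card_range ℓ).le
  have h0 : levelHeight T 0 c = 0 := Nat.eq_zero_of_not_pos fun h => by
    have := (lt_levelHeight_iff hlam hT (Nat.zero_le n) c 0).1 h
    have := h1 0 c
    omega
  have hmono : ∀ v < n, levelHeight T v c ≤ levelHeight T (v + 1) c := fun v hv =>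
    le_of_forall_lt fun r hr => (lt_levelHeight_iff hlam hT (by omega) c r).2
      (((lt_levelHeight_iff hlam hT hv.le c r).1 hr).trans (Nat.le_succ v))
  rw [← Finset.prod_range_mul_prod_Ico _ hle, Finset.prod_eq_one (s := Finset.Ico _ ℓ), mul_one]
  · have key : ∀ m ≤ n, ∏ r ∈ Finset.range (levelHeight T m c), entryWeight n x t (entry T) r c =
        ∏ v ∈ Finset.range m,
          stripWeight (x (v + 1)) t (levelHeight T v c) (levelHeight T (v + 1) c) := by
      intro m
      induction m with
      | zero => simp [h0]
      | succ m ih =>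
        intro hm
        rw [Finset.prod_range_succ, ← ih (by omega), ← prod_Ico_ite_eq_stripWeight,
          ← Finset.prod_range_mul_prod_Ico _ (hmono m hm)]
        congr 1
        refine Finset.prod_congr rfl fun r hr => ?_
        obtain ⟨hr1, hr2⟩ := Finset.mem_Ico.1 hr
        rw [← not_lt, lt_levelHeight_iff hlam hT (by omega)] at hr1
        rw [lt_levelHeight_iff hlam hT hm] at hr2
        have he : entry T r c = m + 1 := by omega
        have hs : entry T r c ≤ entry T (r + 1) c := h3 c (Nat.le_succ r)
        rw [entryWeight, he, if_neg (by omega)]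
        refine if_congr ?_ rfl rfl
        rw [lt_levelHeight_iff hlam hT hm]
        omega
    exact key n le_rfl
  · intro r hr
    have hr1 := (Finset.mem_Ico.1 hr).1
    rw [← not_lt, lt_levelHeight_iff hlam hT le_rfl] at hr1
    have := entry_le T r c
    exact if_pos (by omega)

lemma dualGroth_eq_sum_heights (hlam : ∀ a b : ℕ, a ≤ b → b < ℓ → lam b ≤ lam a) (x t : ℕ → R) :
    dualGroth ℓ n lam (fun _ => 0) x t =
      ∑ H : Fin (n + 1) → Fin (lam 0) → Fin (ℓ + 1), if IsHeights H then
        ∏ v : Fin n, ∏ c, stripWeight (x (v + 1)) t (H v.castSucc c) (H v.succ c) else 0 := by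
  rw [← Finset.sum_filter, dualGroth]
  refine Finset.sum_bij' (fun T _ => heights T) (fun H _ => fillingOfHeights H)
    (fun T hT => ?_) (fun H hH => ?_) (fun T hT => ?_) (fun H hH => ?_) (fun T hT => ?_)
  · simpa using isHeights_heights hlam (Finset.mem_filter.1 hT).2
  · simpa using isSkewRPP_fillingOfHeights hlam (Finset.mem_filter.1 hH).2
  · exact fillingOfHeights_heights hlam (Finset.mem_filter.1 hT).2
  · exact heights_fillingOfHeights hlam (Finset.mem_filter.1 hH).2
  · rw [prod_boxWeight hlam, Finset.prod_comm, Finset.prod_comm (s := Finset.univ),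
      ← Fin.prod_univ_eq_prod_range]
    refine Finset.prod_congr rfl fun c _ => ?_
    rw [prod_entryWeight_eq_prod_stripWeight hlam x t (Finset.mem_filter.1 hT).2,
      ← Fin.prod_univ_eq_prod_range]
    rfl

lemma stripWeight_mul_stripWeight {K : Type*} [Field K] (y y' : K) (t : ℕ → K)
    (ht : ∀ r, t r ≠ 0) {a b c : ℕ} (hab : a ≤ b) (hbc : b ≤ c) :
    stripWeight y t a b * stripWeight y' t b c =
      (if a = c then 1 else ∏ r ∈ Finset.Ico (a + 1) c, t r) *
        intervalWeight (fun r => y * y' / t r) y' y a c b := by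
  unfold stripWeight intervalWeight
  rcases eq_or_ne a c with rfl | hac
  · obtain rfl : a = b := by omega
    simp
  · rcases eq_or_ne b a with rfl | hba
    · rw [if_neg (lt_irrefl _), if_pos (show b < c by omega), if_neg hac, if_neg hac, if_pos rfl,
        one_mul, mul_comm]
    · rcases eq_or_ne b c with rfl | hbc'
      · rw [if_neg (lt_irrefl _), if_pos (show a < b by omega), if_neg hac, if_neg hac, if_neg hba,
          if_pos rfl, mul_one, mul_comm]
      · rw [if_pos (show a < b by omega), if_pos (show b < c by omega), if_neg hac, if_neg hac,
          if_neg hba, if_neg hbc',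
          ← Finset.prod_Ico_consecutive t (show a + 1 ≤ b by omega) hbc,
          Finset.prod_eq_prod_Ico_succ_bot (show b < c by omega)]
        have := ht b
        field_simp

lemma isHeights_update_iff {H : Fin (n + 1) → Fin (lam 0) → Fin (ℓ + 1)} (hH : IsHeights H) {j : ℕ}
    (hj : j + 1 < n) (b : Fin (lam 0) → Fin (ℓ + 1)) :
    IsHeights (Function.update H ⟨j + 1, by omega⟩ b) ↔
      Antitone b ∧ H ⟨j, by omega⟩ ≤ b ∧ b ≤ H ⟨j + 2, by omega⟩ := by
  obtain ⟨h1, h2, h3, h4⟩ := hH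
  have e1 : ∀ v : Fin (n + 1), (v : ℕ) ≠ j + 1 →
      Function.update H ⟨j + 1, by omega⟩ b v = H v :=
    fun v hv => Function.update_of_ne (fun h => hv (congrArg Fin.val h)) _ _
  constructor
  · rintro ⟨-, -, g3, g4⟩
    refine ⟨?_, ?_, ?_⟩
    · simpa using g4 ⟨j + 1, by omega⟩
    · have := g3 (show (⟨j, by omega⟩ : Fin (n + 1)) ≤ ⟨j + 1, by omega⟩ from
        Fin.mk_le_mk.2 (by omega))
      rwa [e1 _ (by simp), Function.update_self] at this
    · have := g3 (show (⟨j + 1, by omega⟩ : Fin (n + 1)) ≤ ⟨j + 2, by omega⟩ from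
        Fin.mk_le_mk.2 (by omega))
      rwa [e1 ⟨j + 2, _⟩ (by simp), Function.update_self] at this
  · rintro ⟨g1, g2, g3⟩
    refine ⟨fun c => ?_, fun c r => ?_, fun v w hvw => ?_, fun v => ?_⟩
    · rw [e1 _ (by simp)]
      exact h1 c
    · rw [e1 _ (by simp only [Fin.val_last]; omega)]
      exact h2 c r
    · by_cases hv : (v : ℕ) = j + 1
      · rw [show v = ⟨j + 1, by omega⟩ from Fin.ext hv, Function.update_self]
        by_cases hw : (w : ℕ) = j + 1
        · rw [show w = ⟨j + 1, by omega⟩ from Fin.ext hw, Function.update_self]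
        · rw [e1 w hw]
          refine g3.trans (h3 (Fin.le_def.2 ?_))
          have := Fin.le_def.1 hvw
          simp only at this ⊢
          omega
      · rw [e1 v hv]
        by_cases hw : (w : ℕ) = j + 1
        · rw [show w = ⟨j + 1, by omega⟩ from Fin.ext hw, Function.update_self]
          refine le_trans (h3 (Fin.le_def.2 ?_)) g2
          have := Fin.le_def.1 hvw
          simp only at this ⊢
          omega
        · rw [e1 w hw]
          exact h3 hvw
    · by_cases hv : (v : ℕ) = j + 1
      · rwa [show v = ⟨j + 1, by omega⟩ from Fin.ext hv, Function.update_self]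
      · rw [e1 v hv]
        exact h4 v

/-- The part of the weight of an array of heights `H` that depends neither on the row `j + 1` of `H`
nor on the variables `x (j + 1)` and `x (j + 2)`. -/
def heightsCofactor (x t : ℕ → R) (H : Fin (n + 1) → Fin (lam 0) → Fin (ℓ + 1)) {j : ℕ}
    (hj : j + 1 < n) : R :=
  (∏ v ∈ (Finset.univ.erase (⟨j, by omega⟩ : Fin n)).erase ⟨j + 1, hj⟩,
    ∏ c, stripWeight (x (v + 1)) t (H v.castSucc c) (H v.succ c)) *
  ∏ c, if (H ⟨j, by omega⟩ c : ℕ) = H ⟨j + 2, by omega⟩ c then 1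
    else ∏ r ∈ Finset.Ico ((H ⟨j, by omega⟩ c : ℕ) + 1) (H ⟨j + 2, by omega⟩ c), t r

lemma heightsCofactor_comp_swap (x t : ℕ → R) (H : Fin (n + 1) → Fin (lam 0) → Fin (ℓ + 1)) {j : ℕ}
    (hj : j + 1 < n) :
    heightsCofactor (x ∘ Equiv.swap (j + 1) (j + 2)) t H hj = heightsCofactor x t H hj := by
  unfold heightsCofactor
  congr 1
  refine Finset.prod_congr rfl fun v hv => ?_
  simp only [Finset.mem_erase, Fin.ne_iff_vne, Finset.mem_univ, and_true] at hv
  rw [Function.comp, Equiv.swap_apply_of_ne_of_ne (by omega) (by omega)]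

lemma prod_stripWeight_update {K : Type*} [Field K] (x t : ℕ → K) (ht : ∀ r, t r ≠ 0)
    (H : Fin (n + 1) → Fin (lam 0) → Fin (ℓ + 1)) {j : ℕ} (hj : j + 1 < n)
    (b : Fin (lam 0) → Fin (ℓ + 1)) (h1 : H ⟨j, by omega⟩ ≤ b) (h2 : b ≤ H ⟨j + 2, by omega⟩) :
    ∏ v : Fin n, ∏ c, stripWeight (x (v + 1)) t
      (Function.update H ⟨j + 1, by omega⟩ b v.castSucc c)
      (Function.update H ⟨j + 1, by omega⟩ b v.succ c) =
    heightsCofactor x t H hj * ∏ c, intervalWeight (fun r => x (j + 1) * x (j + 2) / t r)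
      (x (j + 2)) (x (j + 1)) (H ⟨j, by omega⟩ c) (H ⟨j + 2, by omega⟩ c) (b c) := by
  have e1 : ∀ v : Fin (n + 1), (v : ℕ) ≠ j + 1 →
      Function.update H ⟨j + 1, by omega⟩ b v = H v :=
    fun v hv => Function.update_of_ne (fun h => hv (congrArg Fin.val h)) _ _
  rw [← Finset.mul_prod_erase _ _ (Finset.mem_univ (⟨j, by omega⟩ : Fin n)),
    ← Finset.mul_prod_erase _ _ (show (⟨j + 1, hj⟩ : Fin n) ∈ Finset.univ.erase ⟨j, by omega⟩ by
      simp), ← mul_assoc, mul_comm, heightsCofactor, mul_assoc]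
  congr 1
  · refine Finset.prod_congr rfl fun v hv => ?_
    simp only [Finset.mem_erase, Fin.ne_iff_vne, Finset.mem_univ, and_true] at hv
    rw [e1 _ (by simp only [Fin.val_castSucc]; omega), e1 _ (by simp only [Fin.val_succ]; omega)]
  · rw [← Finset.prod_mul_distrib, ← Finset.prod_mul_distrib]
    refine Finset.prod_congr rfl fun c _ => ?_
    simp only [Fin.castSucc_mk, Fin.succ_mk, Function.update_self]
    rw [e1 ⟨j, _⟩ (by simp), e1 ⟨j + 1 + 1, _⟩ (by simp)]
    exact stripWeight_mul_stripWeight _ _ t ht (h1 c) (h2 c)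

lemma dualGroth_comp_swap_succ_of_field {K : Type*} [Field K]
    (hlam : ∀ a b : ℕ, a ≤ b → b < ℓ → lam b ≤ lam a) (x t : ℕ → K) (ht : ∀ r, t r ≠ 0) {j : ℕ}
    (hj : j + 1 < n) :
    dualGroth ℓ n lam (fun _ => 0) x t =
      dualGroth ℓ n lam (fun _ => 0) (x ∘ Equiv.swap (j + 1) (j + 2)) t := by
  rw [dualGroth_eq_sum_heights hlam, dualGroth_eq_sum_heights hlam]
  refine sum_ite_eq_of_update ⟨j + 1, by omega⟩ _ _ _ fun H hH => ?_
  have hmono : ∀ {v w : ℕ} (hv : v < n + 1) (hw : w < n + 1), v ≤ w → H ⟨v, hv⟩ ≤ H ⟨w, hw⟩ :=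
    fun hv hw h => hH.2.2.1 (Fin.mk_le_mk.2 h)
  have key := congrArg (heightsCofactor x t H hj * ·) <|
    sum_antitone_intervalWeight_symm (ℓ + 1) (fun r => x (j + 1) * x (j + 2) / t r)
      (x (j + 2)) (x (j + 1)) (H ⟨j, by omega⟩) (H ⟨j + 2, by omega⟩)
      (hH.2.2.2 _) (hH.2.2.2 _) (hmono _ _ (by omega))
  simp only [Finset.mul_sum, mul_ite, mul_zero] at key
  convert key using 2 with b _ b _
  · simp only [isHeights_update_iff hH hj]
    refine if_ctx_congr Iff.rfl (fun hb => ?_) fun _ => rfl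
    exact prod_stripWeight_update x t ht H hj b hb.2.1 hb.2.2
  · simp only [isHeights_update_iff hH hj]
    refine if_ctx_congr Iff.rfl (fun hb => ?_) fun _ => rfl
    rw [prod_stripWeight_update _ t ht H hj b hb.2.1 hb.2.2, heightsCofactor_comp_swap]
    simp [mul_comm]

lemma map_dualGroth {S : Type*} [CommRing S] (f : R →+* S) (mu : ℕ → ℕ) (x t : ℕ → R) :
    f (dualGroth ℓ n lam mu x t) = dualGroth ℓ n lam mu (f ∘ x) (f ∘ t) := by
  simp only [dualGroth, boxWeight, map_sum, map_prod, apply_ite f, map_one, Function.comp]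

lemma dualGroth_comp_swap_succ (hlam : ∀ a b : ℕ, a ≤ b → b < ℓ → lam b ≤ lam a) (x t : ℕ → R)
    {j : ℕ} (hj : j + 1 < n) :
    dualGroth ℓ n lam (fun _ => 0) x t =
      dualGroth ℓ n lam (fun _ => 0) (x ∘ Equiv.swap (j + 1) (j + 2)) t := by
  let A := MvPolynomial (ℕ ⊕ ℕ) ℤ
  let X : ℕ → A := fun i => MvPolynomial.X (Sum.inl i)
  let Y : ℕ → A := fun i => MvPolynomial.X (Sum.inr i)
  let ι := algebraMap A (FractionRing A)
  have hι : Function.Injective ι := IsFractionRing.injective A (FractionRing A)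
  have generic : dualGroth ℓ n lam (fun _ => 0) X Y =
      dualGroth ℓ n lam (fun _ => 0) (X ∘ Equiv.swap (j + 1) (j + 2)) Y := by
    apply hι
    rw [map_dualGroth, map_dualGroth, ← Function.comp_assoc]
    exact dualGroth_comp_swap_succ_of_field hlam _ _
      (fun r => (map_ne_zero_iff ι hι).2 (MvPolynomial.X_ne_zero _)) hj
  let φ : A →+* R := MvPolynomial.eval₂Hom (Int.castRingHom R) (Sum.elim x t)
  have hX : φ ∘ X = x := funext fun i => MvPolynomial.eval₂_X _ _ _
  have hY : φ ∘ Y = t := funext fun i => MvPolynomial.eval₂_X _ _ _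
  have := congrArg φ generic
  rwa [map_dualGroth, map_dualGroth, ← Function.comp_assoc, hX, hY] at this

/-- Symmetry in the variables. -/
theorem dualGroth_comp_swap_one (hlam : ∀ a b : ℕ, a ≤ b → b < ℓ → lam b ≤ lam a) (x t : ℕ → R)
    {j : ℕ} (hj1 : 1 ≤ j) (hjn : j ≤ n) :
    dualGroth ℓ n lam (fun _ => 0) x t =
      dualGroth ℓ n lam (fun _ => 0) (x ∘ Equiv.swap 1 j) t := by
  induction j, hj1 using Nat.le_induction generalizing x with
  | base => simp
  | succ j hj ih =>
    obtain ⟨j, rfl⟩ : ∃ i, j = i + 1 := ⟨j - 1, by omega⟩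
    rw [dualGroth_comp_swap_succ hlam x t (show j + 1 < n by omega), ih _ (by omega)]
    rcases eq_or_ne j 0 with rfl | h0
    · simp
    rw [dualGroth_comp_swap_succ hlam _ t (show j + 1 < n by omega)]
    congr 1
    rw [Function.comp_assoc, Function.comp_assoc, ← Equiv.Perm.coe_mul, ← Equiv.Perm.coe_mul,
      ← mul_assoc, Equiv.swap_mul_swap_mul_swap (by omega) (by omega), Equiv.swap_comm]

end Entry

/-- **Symmetry of refined dual Grothendieck polynomials.**
Suppose `λ_i = λ_{i+1}` for some `1 ≤ i ≤ ℓ-1` (1-indexed; here `lam r` is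
`λ_{r+1}`).  If `2 ≤ i`, then `g_λ(x;t)` is symmetric in the parameters
`t_{i-1}` and `t_i`; if `i = 1`, then `g_λ(x;t)` is unchanged under
exchanging the variable `x_j` with the parameter `t_1`, for any `1 ≤ j ≤ n`. -/
theorem refined_dual_grothendieck_symmetry
    {R : Type*} [CommRing R] (ℓ n : ℕ) (lam : ℕ → ℕ)
    (hlam : ∀ a b : ℕ, a ≤ b → b < ℓ → lam b ≤ lam a)
    (i : ℕ) (hi1 : 1 ≤ i) (hi2 : i ≤ ℓ - 1) (heq : lam (i - 1) = lam i)
    (x t : ℕ → R) :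
    (2 ≤ i →
      dualGroth ℓ n lam (fun _ => 0) x t =
        dualGroth ℓ n lam (fun _ => 0) x (t ∘ Equiv.swap (i - 1) i)) ∧
    (i = 1 → ∀ j : ℕ, 1 ≤ j → j ≤ n →
      dualGroth ℓ n lam (fun _ => 0) x t =
        dualGroth ℓ n lam (fun _ => 0)
          (Function.update x j (t 1)) (Function.update t 1 (x j))) := by
  refine ⟨fun hi => ?_, ?_⟩
  · obtain ⟨i, rfl⟩ : ∃ p, i = p + 1 := ⟨i - 1, by omega⟩
    exact dualGroth_comp_swap hlam x t (by omega) (by omega) heq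
  · rintro rfl j hj1 hjn
    rw [dualGroth_comp_swap_one hlam x t hj1 hjn,
      dualGroth_update_one hlam _ t (hj1.trans hjn) (by omega) heq,
      dualGroth_comp_swap_one hlam _ _ hj1 hjn]
    congr 1
    · ext k
      rcases eq_or_ne k j with rfl | hk
      · simp
      · rcases eq_or_ne k 1 with rfl | hk1
        · simp [hk, hk.symm]
        · simp [hk, hk1, Equiv.swap_apply_of_ne_of_ne]

end
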